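/- Let D be a subset of ℝ that is closed and discrete (equivalently, D ∩ [−M, M] is finite for every M > 0), and let N be a natural number. Then D × {0,1,…,N} is a unique expansion set. Precisely: let a : ℝ → ℕ → ℂ satisfy a(α)(k) = 0 whenever α ∉ D or k > N, and suppose there is a nonempty open subset U of ℂ \ (−∞,0] such that for every z ∈ U the family (a(α)(k) · z^α · (log z)ᵏ)_{α∈D, 0≤k≤N} is absolutely summable with sum equal to 0, where z^α = exp(α · log z) and log denotes the principal branch of the complex logarithm. Then a(α)(k) = 0 for all α and all k. -/

import Mathlib

open Filter Topology Complex in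
/-- An absolutely convergent generalized Dirichlet series with distinct real frequencies that tends
to zero at infinity has only zero coefficients. -/
theorem eq_zero_of_tendsto_tsum_mul_exp {ι : Type*} [Countable ι] {c : ι → ℂ}
    (hc : Summable fun i => ‖c i‖) {f : ι → ℝ} (hf : Function.Injective f)
    (h : Tendsto (fun y : ℝ => ∑' i, c i * exp (f i * y * I)) atTop (𝓝 0)) (j : ι) :
    c j = 0 := by
  classical
  let e : ℝ → ι → ℝ → ℂ := fun T i s => c i * exp (((f i - f j : ℝ) * T * I) * s)
  have he (T : ℝ) (i : ι) (s : ℝ) : ‖e T i s‖ = ‖c i‖ := by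
    have : ((f i - f j : ℝ) * T * I) * s = (((f i - f j) * T * s : ℝ) : ℂ) * I := by
      push_cast; ring
    simp only [e, this, norm_mul, norm_exp_ofReal_mul_I, mul_one]
  have hint (T : ℝ) : HasSum (fun i => ∫ s in (1 : ℝ)..2, e T i s)
      (∫ s in (1 : ℝ)..2, ∑' i, e T i s) := by
    refine intervalIntegral.hasSum_integral_of_dominated_convergence (fun i _ => ‖c i‖)
      (fun i => ?_) (fun i => ?_) ?_ ?_ ?_
    · exact Continuous.aestronglyMeasurable (by fun_prop)
    · exact .of_forall fun s _ => (he T i s).le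
    · exact .of_forall fun s _ => hc
    · exact intervalIntegrable_const
    · exact .of_forall fun s _ =>
        (Summable.of_norm (by simpa only [he] using hc)).hasSum
  have hleft : Tendsto (fun T : ℝ => ∫ s in (1 : ℝ)..2, ∑' i, e T i s) atTop (𝓝 0) := by
    rw [Metric.tendsto_atTop] at h ⊢
    intro ε hε
    obtain ⟨Y, hY⟩ := h (ε / 2) (half_pos hε)
    refine ⟨max Y 0, fun T hT => ?_⟩
    rw [dist_zero_right]
    refine (intervalIntegral.norm_integral_le_of_norm_le_const (C := ε / 2)
      fun s hs => ?_).trans_lt (by norm_num; linarith)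
    rw [Set.uIoc_of_le one_le_two] at hs
    have hTs : Y ≤ T * s := by
      have h0 : 0 ≤ T := (le_max_right _ _).trans hT
      have h1 : Y ≤ T := (le_max_left _ _).trans hT
      nlinarith [hs.1]
    have := hY _ hTs
    rw [dist_zero_right] at this
    have hmul : ∑' i, e T i s =
        (∑' i, c i * exp (f i * (T * s : ℝ) * I)) * exp ((-(f j * (T * s)) : ℝ) * I) := by
      rw [← tsum_mul_right]
      refine tsum_congr fun i => ?_
      simp only [e]
      rw [mul_assoc (c i), ← exp_add]
      congr 2
      push_cast; ring
    rw [hmul, norm_mul, norm_exp_ofReal_mul_I, mul_one]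
    exact this.le
  have hright : Tendsto (fun T : ℝ => ∑' i, ∫ s in (1 : ℝ)..2, e T i s) atTop
      (𝓝 (∑' i, if i = j then c j else 0)) := by
    refine tendsto_tsum_of_dominated_convergence (bound := fun i => ‖c i‖) hc (fun i => ?_) ?_
    · by_cases hij : i = j
      · subst hij
        norm_num [e, intervalIntegral.integral_const]
      · rw [if_neg hij]
        have hγ : f i - f j ≠ 0 := sub_ne_zero.2 (hf.ne hij)
        have hbound : ∀ᶠ T : ℝ in atTop, ‖∫ s in (1 : ℝ)..2, e T i s‖ ≤
            ‖c i‖ * (2 / |f i - f j|) * T⁻¹ := by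
          filter_upwards [eventually_gt_atTop 0] with T hT
          have hne : ((f i - f j : ℝ) * T * I : ℂ) ≠ 0 :=
            mul_ne_zero (mul_ne_zero (ofReal_ne_zero.2 hγ) (ofReal_ne_zero.2 hT.ne')) I_ne_zero
          simp only [e]
          rw [intervalIntegral.integral_const_mul, integral_exp_mul_complex hne, norm_mul,
            norm_div, mul_assoc ‖c i‖]
          have hn (s : ℝ) : ‖exp ((f i - f j : ℝ) * T * I * s)‖ = 1 := by
            have : ((f i - f j : ℝ) * T * I) * s = (((f i - f j) * T * s : ℝ) : ℂ) * I := by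
              push_cast; ring
            rw [this, norm_exp_ofReal_mul_I]
          have hd : ‖((f i - f j : ℝ) * T * I : ℂ)‖ = |f i - f j| * T := by
            rw [norm_mul, norm_mul, norm_real, norm_real, norm_I, mul_one, Real.norm_eq_abs,
              Real.norm_eq_abs, abs_of_pos hT]
          have h2 := norm_sub_le (exp ((f i - f j : ℝ) * T * I * (2 : ℝ)))
            (exp ((f i - f j : ℝ) * T * I * (1 : ℝ)))
          rw [hn, hn, one_add_one_eq_two] at h2
          rw [hd, ← div_eq_mul_inv (2 / _), div_div]
          gcongr
        refine squeeze_zero_norm' hbound ?_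
        simpa using tendsto_inv_atTop_zero.const_mul (‖c i‖ * (2 / |f i - f j|))
    · refine .of_forall fun T i => ?_
      refine (intervalIntegral.norm_integral_le_of_norm_le_const (C := ‖c i‖)
        fun s _ => (he T i s).le).trans (by norm_num)
  rw [tsum_ite_eq] at hright
  exact tendsto_nhds_unique hright (hleft.congr fun T => (hint T).tsum_eq.symm)

open Filter Topology Complex in
/-- Coefficients vanish when a polynomial in `w`, whose coefficients are absolutely convergent
generalized Dirichlet series, vanishes on a vertical line. -/
theorem eq_zero_of_sum_pow_mul_tsum_exp_eq_zero_on_line {a : ℝ → ℕ → ℂ} {x : ℝ}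
    (ha : ∀ k, Summable fun α : ℝ => ‖a α k‖ * Real.exp (α * x)) (n : ℕ)
    (h : ∀ w : ℂ, w.re = x →
      ∑ k ∈ Finset.range n, w ^ k * ∑' α : ℝ, a α k * exp (α * w) = 0) :
    ∀ k < n, ∀ α, a α k = 0 := by
  have hnorm (α : ℝ) (k : ℕ) {w : ℂ} (hw : w.re = x) :
      ‖a α k * exp (α * w)‖ = ‖a α k‖ * Real.exp (α * x) := by
    simp [norm_exp, hw]
  induction n with
  | zero => simp
  | succ n ih =>
    let w : ℝ → ℂ := fun y => x + y * I
    have hre (y : ℝ) : (w y).re = x := by simp [w]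
    have hy (y : ℝ) : |y| ≤ ‖w y‖ := by simpa [w] using abs_im_le_norm (w y)
    have hw : Tendsto (fun y : ℝ => (w y)⁻¹) atTop (𝓝 0) :=
      tendsto_inv₀_cobounded.comp <| tendsto_norm_atTop_iff_cobounded.1 <|
        tendsto_atTop_mono hy tendsto_abs_atTop_atTop
    have hlim : Tendsto (fun y : ℝ => ∑' α : ℝ, a α n * exp (α * w y)) atTop (𝓝 0) := by
      have hterm : ∀ k ∈ Finset.range n, Tendsto
          (fun y : ℝ => (w y)⁻¹ ^ (n - k) * ∑' α : ℝ, a α k * exp (α * w y)) atTop (𝓝 0) := by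
        intro k hk
        have hk' : n - k ≠ 0 := Nat.sub_ne_zero_of_lt (Finset.mem_range.1 hk)
        refine Tendsto.zero_mul_isBoundedUnder_le (by simpa [hk'] using hw.pow (n - k)) ?_
        refine isBoundedUnder_of ⟨∑' α : ℝ, ‖a α k‖ * Real.exp (α * x), fun y => ?_⟩
        exact tsum_of_norm_bounded (ha k).hasSum fun α => (hnorm α k (hre y)).le
      have hs := (tendsto_finsetSum _ hterm).neg
      simp only [Finset.sum_const_zero, neg_zero] at hs
      refine hs.congr' ?_
      filter_upwards [eventually_gt_atTop 0] with y hy0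
      have hw0 : w y ≠ 0 := norm_pos_iff.1 ((abs_pos.2 hy0.ne').trans_le (hy y))
      have := h (w y) (hre y)
      rw [Finset.sum_range_succ] at this
      have hn : w y ^ n ≠ 0 := pow_ne_zero _ hw0
      apply mul_left_cancel₀ hn
      rw [← neg_eq_iff_add_eq_zero.2 this, mul_neg, Finset.mul_sum]
      congr 1
      refine Finset.sum_congr rfl fun k hk => ?_
      rw [← mul_assoc]
      congr 1
      rw [inv_pow, ← div_eq_mul_inv, div_eq_iff (pow_ne_zero _ hw0), ← pow_add,
        Nat.add_sub_cancel' (Finset.mem_range.1 hk).le]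
    have hzero : ∀ α, a α n = 0 := by
      let c : ℝ → ℂ := fun α => a α n * exp (α * x)
      have hc : Summable fun α => ‖c α‖ := by simpa [c, norm_exp] using ha n
      have hcount : Countable (Function.support c) := by
        simpa [Function.support] using hc.countable_support
      have hcy (y : ℝ) : ∑' α : Function.support c, c α * exp ((α : ℝ) * y * I) =
          ∑' α : ℝ, a α n * exp (α * w y) := by
        rw [tsum_subtype_eq_of_support_subset (f := fun α : ℝ => c α * exp (α * y * I))
          (Function.support_mul_subset_left _ _)]
        refine tsum_congr fun α => ?_
        simp only [c, w]
        rw [mul_assoc, ← exp_add]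
        congr 2
        ring
      intro α
      by_contra hα
      have hα' : α ∈ Function.support c := mul_ne_zero hα (exp_ne_zero _)
      exact hα' (eq_zero_of_tendsto_tsum_mul_exp (c := fun α : Function.support c => c α)
        (hc.subtype _) Subtype.val_injective (hlim.congr fun y => (hcy y).symm) ⟨α, hα'⟩)
    intro k hk
    rcases Nat.lt_succ_iff_lt_or_eq.1 hk with hk | rfl
    · refine ih (fun v hv => ?_) k hk
      simpa [Finset.sum_range_succ, hzero] using h v hv
    · exact hzero


/-- For a closed discrete set `D ⊆ ℝ` (i.e. `D ∩ [−M, M]` is finite for every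
  `M > 0`) and `N ∈ ℕ`, the set `D × {0,1,…,N}` is a unique expansion set: if a
  series `∑_{α∈D, 0≤k≤N} a(α)(k) z^α (log z)ᵏ` (with `z^α = exp(α log z)`, `log`
  the principal branch) converges absolutely to `0` for all `z` in some nonempty
  open subset `U` of the slit plane `ℂ \ (−∞,0]`, then all coefficients vanish. -/
theorem discrete_real_unique_expansion_set
    (D : Set ℝ) (hD : ∀ M : ℝ, 0 < M → (D ∩ Set.Icc (-M) M).Finite)
    (N : ℕ) (a : ℝ → ℕ → ℂ)
    (ha : ∀ (α : ℝ) (k : ℕ), (α ∉ D ∨ N < k) → a α k = 0)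
    (U : Set ℂ) (hU : IsOpen U) (hne : U.Nonempty)
    (hUslit : U ⊆ Complex.slitPlane)
    (hsum : ∀ z ∈ U,
      Summable (fun p : ℝ × ℕ =>
          ‖a p.1 p.2 * z ^ (p.1 : ℂ) * Complex.log z ^ p.2‖) ∧
        ∑' p : ℝ × ℕ, a p.1 p.2 * z ^ (p.1 : ℂ) * Complex.log z ^ p.2 = 0) :
    ∀ (α : ℝ) (k : ℕ), a α k = 0 := by
  let W : Set ℂ := (Complex.exp ⁻¹' U ∩ {w | w.im ∈ Set.Ioo (-Real.pi) Real.pi}) ∩ {0}ᶜ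
  have hV : IsOpen (Complex.exp ⁻¹' U ∩ {w : ℂ | w.im ∈ Set.Ioo (-Real.pi) Real.pi}) :=
    (hU.preimage Complex.continuous_exp).inter (isOpen_Ioo.preimage Complex.continuous_im)
  have hW : IsOpen W := hV.inter isOpen_compl_singleton
  obtain ⟨w₀, hw₀⟩ : W.Nonempty := by
    obtain ⟨z, hz⟩ := hne
    refine (dense_compl_singleton (0 : ℂ)).inter_open_nonempty _ hV ⟨Complex.log z, ?_, ?_⟩
    · simpa [Complex.exp_log (Complex.slitPlane_ne_zero (hUslit hz))] using hz
    · rw [Set.mem_ofPred_eq, Complex.log_im]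
      exact ⟨Complex.neg_pi_lt_arg z, (Complex.arg_le_pi z).lt_of_ne
        (Complex.mem_slitPlane_iff_arg.1 (hUslit hz)).1⟩
  have hterm {w : ℂ} (hw : w ∈ W) (p : ℝ × ℕ) :
      a p.1 p.2 * Complex.exp w ^ (p.1 : ℂ) * Complex.log (Complex.exp w) ^ p.2 =
        w ^ p.2 * (a p.1 p.2 * Complex.exp (p.1 * w)) := by
    rw [Complex.cpow_def_of_ne_zero (Complex.exp_ne_zero w),
      Complex.log_exp hw.1.2.1 hw.1.2.2.le, mul_comm w]
    ring
  have hsumW {w : ℂ} (hw : w ∈ W) :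
      Summable (fun p : ℝ × ℕ => w ^ p.2 * (a p.1 p.2 * Complex.exp (p.1 * w))) :=
    .of_norm (by simpa only [hterm hw] using (hsum _ hw.1.1).1)
  have hcoeff {w : ℂ} (hw : w ∈ W) (k : ℕ) :
      Summable fun α : ℝ => ‖a α k‖ * Real.exp (α * w.re) := by
    have h := (hsumW hw).norm.comp_injective (i := fun α : ℝ => (α, k))
      (Prod.mk_left_injective k)
    have hk : ‖w ^ k‖ ≠ 0 := norm_ne_zero_iff.2 (pow_ne_zero _ hw.2)
    simp only [Function.comp_def, norm_mul (w ^ k)] at h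
    rw [summable_mul_left_iff hk] at h
    simpa [Complex.norm_exp] using h
  let F : ℂ → ℂ := fun w =>
    ∑ k ∈ Finset.range (N + 1), w ^ k * ∑' α : ℝ, a α k * Complex.exp (α * w)
  have hFW : ∀ w ∈ W, F w = 0 := by
    intro w hw
    have h0 := (hsum _ hw.1.1).2
    simp only [hterm hw] at h0
    have hswap := (Equiv.prodComm ℕ ℝ).summable_iff.2 (hsumW hw)
    simp only [Function.comp_def] at hswap
    rw [← h0, ← (Equiv.prodComm ℕ ℝ).tsum_eq, hswap.tsum_prod,
      tsum_eq_sum (s := Finset.range (N + 1))]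
    · simp [F, tsum_mul_left]
    · intro k hk
      have : N < k := not_le.1 fun h => hk (Finset.mem_range.2 (Nat.lt_succ_of_le h))
      simp [fun α => ha α k (.inr this)]
  obtain ⟨r, hr, hball⟩ := Metric.isOpen_iff.1 hW w₀ hw₀
  have hmem {t : ℝ} (ht : |t| < r) : w₀ + t ∈ W := hball (by simpa using ht)
  have habs : |r / 2| < r := by rw [abs_of_pos (half_pos hr)]; exact half_lt_self hr
  have h₁ (k : ℕ) := hcoeff (hmem (t := -(r / 2)) (by rwa [abs_neg])) k
  have h₂ (k : ℕ) := hcoeff (hmem habs) k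
  let S : Set ℂ := {w | w.re ∈ Set.Ioo (w₀ + (-(r / 2) : ℝ)).re (w₀ + (r / 2 : ℝ)).re}
  have hSopen : IsOpen S := isOpen_Ioo.preimage Complex.continuous_re
  have hSconn : IsPreconnected S :=
    ((convex_Ioo _ _).linear_preimage Complex.reLm).isPreconnected
  have hw₀S : w₀ ∈ S := by simp [S, hr]
  have hF : DifferentiableOn ℂ F S := by
    refine DifferentiableOn.fun_sum fun k _ => (differentiableOn_id.pow k).mul ?_
    refine Complex.differentiableOn_tsum_of_summable_norm ((h₁ k).add (h₂ k))
      (fun α => by fun_prop) hSopen fun α w hw => ?_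
    rw [norm_mul, Complex.norm_exp, ← mul_add]
    gcongr
    rw [Complex.re_ofReal_mul]
    rcases le_total 0 α with hα | hα
    · exact (Real.exp_le_exp.2 (mul_le_mul_of_nonneg_left hw.2.le hα)).trans
        (le_add_of_nonneg_left (Real.exp_pos _).le)
    · exact (Real.exp_le_exp.2 (mul_le_mul_of_nonpos_left hw.1.le hα)).trans
        (le_add_of_nonneg_right (Real.exp_pos _).le)
  have hFS : Set.EqOn F 0 S :=
    (hF.analyticOnNhd hSopen).eqOn_zero_of_preconnected_of_eventuallyEq_zero hSconn hw₀S
      (Filter.eventually_of_mem (hW.mem_nhds hw₀) hFW)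
  intro α k
  rcases lt_or_ge N k with hk | hk
  · exact ha α k (.inr hk)
  · refine eq_zero_of_sum_pow_mul_tsum_exp_eq_zero_on_line (hcoeff hw₀) (N + 1)
      (fun w hw => hFS ?_) k (Nat.lt_succ_of_le hk) α
    simpa only [S, Set.mem_ofPred_eq, hw] using hw₀S
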